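/- arXiv:1210.0521 — 3 statements merged into one kernel-verified Lean document; each statement's English description precedes it below -/
import Mathlib

section
/- Let f : X → X be a continuous map of a compact metric space and φ : X → ℝ continuous. Then limsup_{n→∞} (sup_X (1/n) S_n(φ)) ≤ sup over f-invariant Borel probability measures ν of ∫ φ dν. In particular, there exists an f-invariant Borel probability measure ν with ∫ φ dν = limsup_{n→∞} sup_X (1/n) S_n(φ). -/
open MeasureTheory Filter

open scoped Topology BoundedContinuousFunction

/-- The empirical measure along the first `n` points of an orbit is a probability measure whose
integrals are Birkhoff averages. -/
lemma exists_probabilityMeasure_integral_eq_birkhoffAverage {X : Type*} [TopologicalSpace X]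
    [MeasurableSpace X] [BorelSpace X] (f : X → X) {n : ℕ} (hn : n ≠ 0) (x : X) :
    ∃ μ : ProbabilityMeasure X, ∀ ψ : X →ᵇ ℝ,
      ∫ y, ψ y ∂(μ : Measure X) = birkhoffAverage ℝ f ψ n x := by
  refine ⟨⟨(n : ENNReal)⁻¹ • ∑ k ∈ Finset.range n, Measure.dirac (f^[k] x), ⟨?_⟩⟩, fun ψ ↦ ?_⟩
  · simp [ENNReal.inv_mul_cancel (Nat.cast_ne_zero.2 hn) (ENNReal.natCast_ne_top n)]
  · have hψ (y : X) : ∫ z, ψ z ∂Measure.dirac y = ψ y :=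
      integral_dirac' _ _ ψ.continuous.measurable.stronglyMeasurable
    simp only [ProbabilityMeasure.coe_mk, integral_smul_measure]
    rw [integral_finsetSum_measure fun k _ ↦ ψ.integrable _]
    simp [hψ, birkhoffAverage, birkhoffSum]

/-- Every cluster value of Birkhoff averages of `φ`, along arbitrary starting points, is the
integral of `φ` against an invariant probability measure. -/
lemma exists_measurePreserving_integral_eq_of_mapClusterPt {X : Type*} [TopologicalSpace X]
    [TopologicalSpace.PseudoMetrizableSpace X] [T2Space X] [CompactSpace X]
    [MeasurableSpace X] [BorelSpace X] {f : X → X} (hf : Continuous f) (φ : X →ᵇ ℝ)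
    (x : ℕ → X) {L : ℝ}
    (hL : MapClusterPt L atTop fun n ↦ birkhoffAverage ℝ f φ n (x n)) :
    ∃ ν : Measure X, IsProbabilityMeasure ν ∧ MeasurePreserving f ν ν ∧ ∫ y, φ y ∂ν = L := by
  have hμ (n : ℕ) : ∃ μ : ProbabilityMeasure X, n ≠ 0 → ∀ ψ : X →ᵇ ℝ,
      ∫ y, ψ y ∂(μ : Measure X) = birkhoffAverage ℝ f ψ n (x n) := by
    rcases eq_or_ne n 0 with rfl | hn
    · exact ⟨⟨Measure.dirac (x 0), inferInstance⟩, fun h ↦ absurd rfl h⟩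
    · obtain ⟨μ, hμ⟩ := exists_probabilityMeasure_integral_eq_birkhoffAverage f hn (x n)
      exact ⟨μ, fun _ ↦ hμ⟩
  choose μ hμ using hμ
  obtain ⟨U, hU, hUL⟩ := mapClusterPt_iff_ultrafilter.1 hL
  obtain ⟨ν, -, hν⟩ := isCompact_univ.ultrafilter_le_nhds (U.map μ) (by simp)
  have hlim (ψ : X →ᵇ ℝ) : Tendsto (fun n ↦ birkhoffAverage ℝ f ψ n (x n)) U
      (𝓝 (∫ y, ψ y ∂(ν : Measure X))) := by
    refine (ProbabilityMeasure.tendsto_iff_forall_integral_tendsto.1 hν ψ).congr' ?_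
    filter_upwards [hU (eventually_ne_atTop 0)] with n hn using hμ n hn ψ
  refine ⟨ν, inferInstance, ⟨hf.measurable, ?_⟩, tendsto_nhds_unique (hlim φ) hUL⟩
  have := Measure.isProbabilityMeasure_map (μ := (ν : Measure X)) hf.aemeasurable
  refine ext_of_forall_integral_eq_of_IsFiniteMeasure fun ψ ↦ ?_
  rw [integral_map hf.aemeasurable ψ.continuous.aestronglyMeasurable]
  have hdiff : Tendsto (fun n ↦ birkhoffAverage ℝ f ψ n (f (x n)) -
      birkhoffAverage ℝ f ψ n (x n)) atTop (𝓝 0) := by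
    have h0 : Tendsto (fun n : ℕ ↦ 2 * ‖ψ‖ / n) atTop (𝓝 0) :=
      tendsto_const_nhds.div_atTop tendsto_natCast_atTop_atTop
    refine squeeze_zero_norm (fun n ↦ ?_) h0
    rw [← dist_eq_norm, dist_birkhoffAverage_apply_birkhoffAverage]
    gcongr
    exact ψ.dist_le_two_norm _ _
  have h1 := (hdiff.mono_left hU).add (hlim ψ)
  have h2 := hlim (ψ.compContinuous ⟨f, hf⟩)
  refine tendsto_nhds_unique (h2.congr fun n ↦ ?_) (by simpa using h1)
  simp [birkhoffAverage, birkhoffSum, (Function.Commute.iterate_self f _).eq]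

/-- `limsup_n sup_X (1/n) S_n(φ) ≤ sup_{ν invariant} ∫ φ dν`, and moreover some
invariant Borel probability measure attains the limsup. -/
theorem stmt3 {X : Type*} [MetricSpace X] [CompactSpace X] [Nonempty X]
    [MeasurableSpace X] [BorelSpace X]
    (f : X → X) (hf : Continuous f) (φ : X → ℝ) (hφ : Continuous φ)
    (L : ℝ)
    (hL : L = Filter.atTop.limsup
      (fun n : ℕ => ⨆ x : X, (1 / (n : ℝ)) * ∑ j ∈ Finset.range n, φ (f^[j] x))) :
    L ≤ sSup {r : ℝ | ∃ μ : Measure X, IsProbabilityMeasure μ ∧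
        MeasurePreserving f μ μ ∧ r = ∫ x, φ x ∂μ} ∧
    ∃ ν : Measure X, IsProbabilityMeasure ν ∧ MeasurePreserving f ν ν ∧
      ∫ x, φ x ∂ν = L := by
  let Φ : X →ᵇ ℝ := BoundedContinuousFunction.mkOfCompact ⟨φ, hφ⟩
  have hmax (n : ℕ) : ∃ x, ⨆ y : X, (1 / (n : ℝ)) * ∑ j ∈ Finset.range n, φ (f^[j] y) =
      birkhoffAverage ℝ f Φ n x := by
    have hc : Continuous fun y ↦ (1 / (n : ℝ)) * ∑ j ∈ Finset.range n, φ (f^[j] y) :=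
      continuous_const.mul (continuous_finsetSum _ fun j _ ↦ hφ.comp (hf.iterate j))
    obtain ⟨x, -, hx⟩ := isCompact_univ.exists_sSup_image_eq Set.univ_nonempty hc.continuousOn
    refine ⟨x, ?_⟩
    rw [Set.image_univ] at hx
    rw [iSup, hx]
    simp [birkhoffAverage, birkhoffSum, Φ]
  choose x hx using hmax
  simp only [hx] at hL
  have hbd (n : ℕ) : |birkhoffAverage ℝ f Φ n (x n)| ≤ ‖Φ‖ := by
    rcases eq_or_ne n 0 with rfl | hn
    · simp
    · obtain ⟨μ, hμ⟩ := exists_probabilityMeasure_integral_eq_birkhoffAverage f hn (x n)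
      rw [← hμ Φ]
      exact Φ.norm_integral_le_norm _
  have hclus : MapClusterPt L atTop fun n ↦ birkhoffAverage ℝ f Φ n (x n) := by
    rw [hL]
    have hle : IsBoundedUnder (· ≤ ·) atTop fun n ↦ birkhoffAverage ℝ f Φ n (x n) :=
      isBoundedUnder_of ⟨‖Φ‖, fun n ↦ (abs_le.1 (hbd n)).2⟩
    have hge : IsBoundedUnder (· ≥ ·) atTop fun n ↦ birkhoffAverage ℝ f Φ n (x n) :=
      isBoundedUnder_of ⟨-‖Φ‖, fun n ↦ (abs_le.1 (hbd n)).1⟩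
    exact MapClusterPt.limsup hge.isCoboundedUnder_le hle
  obtain ⟨ν, hν, hfν, hνL⟩ := exists_measurePreserving_integral_eq_of_mapClusterPt hf Φ x hclus
  refine ⟨le_csSup ⟨‖Φ‖, ?_⟩ ⟨ν, hν, hfν, hνL.symm⟩, ν, hν, hfν, hνL⟩
  rintro _ ⟨μ, hμ, -, rfl⟩
  exact (le_abs_self _).trans (Φ.norm_integral_le_norm μ)
end

section
/- Let f : X → X be a continuous map of a compact metric space. A continuous potential φ : X → ℝ is called hyperbolic for f if for some integer n ≥ 1, sup_X (1/n) S_n(φ) < P(f,φ), where P(f,φ) is the topological pressure. Then φ is hyperbolic for f if and only if sup over f-invariant Borel probability measures μ of ∫ φ dμ < P(f,φ). -/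
open MeasureTheory Filter

open scoped Topology ENNReal BoundedContinuousFunction

/-- The uniform probability measure on the first `n` points of the orbit of `x` under `f`. -/
noncomputable def empiricalMeasure {X : Type*} [MeasurableSpace X] (f : X → X) (n : ℕ) (x : X) :
    Measure X :=
  (n : ℝ≥0∞)⁻¹ • ∑ j ∈ Finset.range n, Measure.dirac (f^[j] x)

lemma isProbabilityMeasure_empiricalMeasure {X : Type*} [MeasurableSpace X] (f : X → X) {n : ℕ}
    (hn : n ≠ 0) (x : X) : IsProbabilityMeasure (empiricalMeasure f n x) := by
  constructor
  simp [empiricalMeasure, ENNReal.inv_mul_cancel, hn]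

lemma integral_empiricalMeasure {X : Type*} [TopologicalSpace X] [MeasurableSpace X]
    [OpensMeasurableSpace X] (f : X → X) (n : ℕ) (x : X) (g : X →ᵇ ℝ) :
    ∫ y, g y ∂(empiricalMeasure f n x) = birkhoffAverage ℝ f g n x := by
  rw [empiricalMeasure, integral_smul_measure, integral_finsetSum_measure fun _ _ ↦ g.integrable _]
  simp [birkhoffAverage, birkhoffSum,
    integral_dirac' _ _ g.continuous.measurable.stronglyMeasurable]

lemma tendsto_birkhoffAverage_comp_sub_birkhoffAverage {X : Type*} [TopologicalSpace X]
    (f : X → X) (g : X →ᵇ ℝ) (x : ℕ → X) :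
    Tendsto (fun n ↦ birkhoffAverage ℝ f (g ∘ f) n (x n) - birkhoffAverage ℝ f g n (x n))
      atTop (𝓝 0) := by
  have h (n : ℕ) : birkhoffAverage ℝ f (g ∘ f) n (x n) - birkhoffAverage ℝ f g n (x n) =
      (n : ℝ)⁻¹ * (g (f^[n] (x n)) - g (x n)) := by
    rw [← smul_eq_mul, ← birkhoffAverage_apply_sub_birkhoffAverage]
    simp only [birkhoffAverage, birkhoffSum, Function.comp_apply,
      ← Function.iterate_succ_apply, ← Function.iterate_succ_apply' f]
  simp only [h]
  refine squeeze_zero_norm (a := fun n : ℕ ↦ (n : ℝ)⁻¹ * (2 * ‖g‖)) (fun n ↦ ?_) ?_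
  · rw [norm_mul, Real.norm_of_nonneg (by positivity : (0 : ℝ) ≤ (n : ℝ)⁻¹), ← dist_eq_norm]
    gcongr
    exact g.dist_le_two_norm _ _
  · simpa using (tendsto_inv_atTop_nhds_zero_nat (𝕜 := ℝ)).mul_const (2 * ‖g‖)

/-- **Krylov–Bogolyubov theorem**: every sequence of empirical measures of growing length
accumulates at an invariant probability measure. -/
theorem exists_measurePreserving_tendsto_birkhoffAverage {X : Type*} [MetricSpace X]
    [CompactSpace X] [MeasurableSpace X] [BorelSpace X] {f : X → X} (hf : Continuous f)
    (x : ℕ → X) :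
    ∃ μ : Measure X, IsProbabilityMeasure μ ∧ MeasurePreserving f μ μ ∧
      ∃ U : Ultrafilter ℕ, (U : Filter ℕ) ≤ atTop ∧ ∀ g : X →ᵇ ℝ,
        Tendsto (fun n ↦ birkhoffAverage ℝ f g n (x n)) U (𝓝 (∫ y, g y ∂μ)) := by
  let U : Ultrafilter ℕ := Ultrafilter.of atTop
  have hU : (U : Filter ℕ) ≤ atTop := Ultrafilter.of_le atTop
  let m (n : ℕ) : ProbabilityMeasure X :=
    ⟨empiricalMeasure f (n + 1) (x (n + 1)),
      isProbabilityMeasure_empiricalMeasure f n.succ_ne_zero _⟩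
  obtain ⟨μ, -, hμ⟩ := isCompact_univ.ultrafilter_le_nhds (U.map fun n ↦ m (n - 1)) (by simp)
  have hlim (g : X →ᵇ ℝ) :
      Tendsto (fun n ↦ birkhoffAverage ℝ f g n (x n)) U (𝓝 (∫ y, g y ∂(μ : Measure X))) := by
    refine (ProbabilityMeasure.tendsto_iff_forall_integral_tendsto.1 hμ g).congr' ?_
    filter_upwards [hU (eventually_ge_atTop 1)] with n hn
    obtain ⟨k, rfl⟩ := Nat.exists_eq_add_of_le' hn
    exact integral_empiricalMeasure f _ _ g
  refine ⟨μ, inferInstance, ⟨hf.measurable, ?_⟩, U, hU, hlim⟩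
  have := Measure.isProbabilityMeasure_map (μ := (μ : Measure X)) hf.aemeasurable
  refine ext_of_forall_integral_eq_of_IsFiniteMeasure fun g ↦ ?_
  rw [integral_map hf.aemeasurable g.continuous.aestronglyMeasurable]
  have h := (hlim (g.compContinuous ⟨f, hf⟩)).sub (hlim g)
  exact sub_eq_zero.1 <| tendsto_nhds_unique h
    ((tendsto_birkhoffAverage_comp_sub_birkhoffAverage f g x).mono_left hU)

lemma integral_birkhoffAverage {X : Type*} [MeasurableSpace X] {f : X → X} {μ : Measure X}
    (hf : MeasurePreserving f μ μ) {g : X → ℝ} (hg : Integrable g μ) {n : ℕ} (hn : n ≠ 0) :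
    ∫ x, birkhoffAverage ℝ f g n x ∂μ = ∫ x, g x ∂μ := by
  have h (j : ℕ) : ∫ x, g (f^[j] x) ∂μ = ∫ x, g x ∂μ := by
    have hj := hf.iterate j
    rw [← integral_map hj.measurable.aemeasurable (hj.map_eq.symm ▸ hg.aestronglyMeasurable),
      hj.map_eq]
  simp only [birkhoffAverage, birkhoffSum, smul_eq_mul]
  have hint (j : ℕ) : Integrable (fun x ↦ g (f^[j] x)) μ :=
    (hf.iterate j).integrable_comp_of_integrable hg
  rw [integral_const_mul, integral_finsetSum _ fun j _ ↦ hint j]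
  simp [h, hn]

/-- A continuous potential `φ` is hyperbolic for `f` (i.e. for some `n ≥ 1`,
`sup_X (1/n) S_n(φ) < P(f,φ)`) if and only if
`sup_{μ invariant} ∫ φ dμ < P(f,φ)`, where the pressure is defined via the
variational principle with an abstract entropy function `hent`. -/
theorem stmt4 {X : Type*} [MetricSpace X] [CompactSpace X] [Nonempty X]
    [MeasurableSpace X] [BorelSpace X]
    (f : X → X) (hf : Continuous f) (φ : X → ℝ) (hφ : Continuous φ)
    (hent : Measure X → ℝ) (P : ℝ)
    (hP : P = sSup {r : ℝ | ∃ ν : Measure X, IsProbabilityMeasure ν ∧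
      MeasurePreserving f ν ν ∧ r = hent ν + ∫ x, φ x ∂ν}) :
    (∃ n : ℕ, 1 ≤ n ∧
        (⨆ x : X, (1 / (n : ℝ)) * ∑ j ∈ Finset.range n, φ (f^[j] x)) < P) ↔
      sSup {r : ℝ | ∃ μ : Measure X, IsProbabilityMeasure μ ∧
        MeasurePreserving f μ μ ∧ r = ∫ x, φ x ∂μ} < P := by
  let φb : X →ᵇ ℝ := BoundedContinuousFunction.mkOfCompact ⟨φ, hφ⟩
  have hA (n : ℕ) (x : X) : (1 / (n : ℝ)) * ∑ j ∈ Finset.range n, φ (f^[j] x) =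
      birkhoffAverage ℝ f φ n x := by
    simp [birkhoffAverage, birkhoffSum]
  have hcont (n : ℕ) : Continuous (birkhoffAverage ℝ f φ n) := by
    rw [← funext (hA n)]
    exact continuous_const.mul (continuous_finsetSum _ fun j _ ↦ hφ.comp (hf.iterate j))
  simp only [hA]
  constructor
  · rintro ⟨n, hn, hlt⟩
    refine (csSup_le ?_ ?_).trans_lt hlt
    · obtain ⟨μ, hμ, hinv, -⟩ := exists_measurePreserving_tendsto_birkhoffAverage hf
        fun _ ↦ Classical.arbitrary X
      exact ⟨_, μ, hμ, hinv, rfl⟩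
    · rintro _ ⟨μ, hμ, hinv, rfl⟩
      have hφi : Integrable φ μ := φb.integrable μ
      rw [← integral_birkhoffAverage hinv hφi (by lia : n ≠ 0)]
      have hint : Integrable (birkhoffAverage ℝ f φ n) μ :=
        (BoundedContinuousFunction.mkOfCompact ⟨_, hcont n⟩).integrable μ
      have hle := integral_mono hint (integrable_const _)
        fun x ↦ le_ciSup (isCompact_range (hcont n)).bddAbove x
      simpa using hle
  · contrapose!
    intro h
    have hmax (n : ℕ) : ∃ x, 1 ≤ n → P ≤ birkhoffAverage ℝ f φ n x := by
      obtain ⟨x, -, hx⟩ := isCompact_univ.exists_isMaxOn Set.univ_nonempty (hcont n).continuousOn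
      exact ⟨x, fun hn ↦ (h n hn).trans (ciSup_le fun y ↦ hx (Set.mem_univ y))⟩
    choose x hx using hmax
    obtain ⟨μ, hμ, hinv, U, hU, hlim⟩ := exists_measurePreserving_tendsto_birkhoffAverage hf x
    refine (ge_of_tendsto (hlim φb) ?_).trans (le_csSup ⟨‖φb‖, ?_⟩ ⟨μ, hμ, hinv, rfl⟩)
    · filter_upwards [hU (eventually_ge_atTop 1)] with n hn using hx n hn
    · rintro _ ⟨ν, hν, -, rfl⟩
      exact (le_abs_self _).trans (φb.norm_integral_le_norm ν)
end

section
/- Let f : X → X be continuous on a compact metric space, φ : X → ℝ continuous, and ν an f-invariant ergodic Borel probability measure. Then for ν-almost every x and every D' > 0, there exist a strictly increasing sequence of positive integers (n_l) and points x_l ∈ f^{−n_l}(x) such that x_{l+1} ∈ f^{−(n_{l+1} − n_l)}({x_l}) and S_{n_l}(φ)(x_l) ≥ n_l ∫ φ dν − D' for every l. -/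
open MeasureTheory Filter

theorem iterate_compMeasurePreserving_toLp_ae {X : Type*} [MeasurableSpace X] {ν : Measure X}
    {f : X → X} (hf : MeasurePreserving f ν ν) {ψ : X → ℝ} (hψ : MemLp ψ 2 ν) (k : ℕ) :
    (Lp.compMeasurePreserving f hf)^[k] (hψ.toLp ψ) =ᵐ[ν] ψ ∘ f^[k] := by
  induction k with
  | zero => simpa using hψ.coeFn_toLp
  | succ k ih =>
    rw [Function.iterate_succ_apply', Function.iterate_succ, ← Function.comp_assoc]
    exact (Lp.coeFn_compMeasurePreserving _ hf).trans
      (hf.quasiMeasurePreserving.ae_eq_comp ih)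

theorem birkhoffSum_compMeasurePreserving_toLp_ae {X : Type*} [MeasurableSpace X] {ν : Measure X}
    {f : X → X} (hf : MeasurePreserving f ν ν) {ψ : X → ℝ} (hψ : MemLp ψ 2 ν) (n : ℕ) :
    (birkhoffSum (Lp.compMeasurePreserving f hf) id n (hψ.toLp ψ) : Lp ℝ 2 ν)
      =ᵐ[ν] birkhoffSum f ψ n := by
  induction n with
  | zero => simpa using Lp.coeFn_zero ℝ 2 ν
  | succ n ih =>
    rw [birkhoffSum_succ]
    filter_upwards [ih, iterate_compMeasurePreserving_toLp_ae hf hψ n, Lp.coeFn_add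
      (birkhoffSum (Lp.compMeasurePreserving f hf) id n (hψ.toLp ψ))
      ((Lp.compMeasurePreserving f hf)^[n] (hψ.toLp ψ))] with x h1 h2 h3
    simp only [id, Pi.add_apply] at h3 ⊢
    rw [h3, h2, birkhoffSum_succ]
    congr 1

theorem Ergodic.tendsto_integral_abs_birkhoffAverage {X : Type*} [MeasurableSpace X]
    {ν : Measure X} [IsProbabilityMeasure ν] {f : X → X} (hf : Ergodic f ν)
    {ψ : X → ℝ} (hψ : MemLp ψ 2 ν) (h0 : ∫ x, ψ x ∂ν = 0) :
    Tendsto (fun n => ∫ x, |birkhoffAverage ℝ f ψ n x| ∂ν) atTop (nhds 0) := by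
  have hmp := hf.toMeasurePreserving
  obtain ⟨U, hUf⟩ : ∃ U : Lp ℝ 2 ν →L[ℝ] Lp ℝ 2 ν, ⇑U = Lp.compMeasurePreserving f hmp :=
    ⟨(Lp.compMeasurePreservingₗᵢ ℝ f hmp).toContinuousLinearMap, rfl⟩
  have hU : ‖U‖ ≤ 1 := U.opNorm_le_bound zero_le_one fun g => by
    rw [hUf, Lp.norm_compMeasurePreserving, one_mul]
  have key := U.tendsto_birkhoffAverage_orthogonalProjection hU (hψ.toLp ψ)
  set p := (U.eqLocus (1 : Lp ℝ 2 ν →L[ℝ] Lp ℝ 2 ν)).orthogonalProjectionOnto (hψ.toLp ψ)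
  have hp0 : (p : Lp ℝ 2 ν) = 0 := by
    have hfix : U p = p := p.2
    have h1 : (p : Lp ℝ 2 ν) ∘ f =ᵐ[ν] (p : Lp ℝ 2 ν) := by
      have := Lp.coeFn_compMeasurePreserving (p : Lp ℝ 2 ν) hmp
      exact this.symm.trans (by rw [← hUf, hfix])
    obtain ⟨c, hc⟩ := hf.ae_eq_const_of_ae_eq_comp_ae (Lp.aestronglyMeasurable _) h1
    have h2 : inner ℝ (p : Lp ℝ 2 ν) (hψ.toLp ψ) = 0 := by
      rw [L2.inner_def, integral_congr_ae (g := fun x => c * ψ x), integral_const_mul, h0,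
        mul_zero]
      filter_upwards [hc, hψ.coeFn_toLp] with x hx hx'
      simp [hx, hx', mul_comm]
    have h3 : inner ℝ (p : Lp ℝ 2 ν) (hψ.toLp ψ - p) = 0 :=
      Submodule.inner_right_of_mem_orthogonal p.2
        (Submodule.sub_starProjection_mem_orthogonal _)
    rw [inner_sub_right, h2, zero_sub, neg_eq_zero] at h3
    exact inner_self_eq_zero.1 h3
  rw [hp0] at key
  have key' := key.norm
  rw [norm_zero] at key'
  refine squeeze_zero (fun n => integral_nonneg fun x => abs_nonneg _) (fun n => ?_) key'
  have hae : (birkhoffAverage ℝ U id n (hψ.toLp ψ) : Lp ℝ 2 ν) =ᵐ[ν] birkhoffAverage ℝ f ψ n := by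
    filter_upwards [birkhoffSum_compMeasurePreserving_toLp_ae hmp hψ n,
      Lp.coeFn_smul ((n : ℝ)⁻¹)
        (birkhoffSum (Lp.compMeasurePreserving f hmp) id n (hψ.toLp ψ))] with x h1 h2
    simp only [birkhoffAverage]
    rw [← h1, hUf]
    exact h2
  have hm : MemLp (birkhoffAverage ℝ U id n (hψ.toLp ψ) : Lp ℝ 2 ν) 2 ν := Lp.memLp _
  rw [integral_congr_ae (g := fun x => ‖(birkhoffAverage ℝ U id n (hψ.toLp ψ) : Lp ℝ 2 ν) x‖)
    (by filter_upwards [hae] with x hx; simp [hx]), Lp.norm_def,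
    integral_norm_eq_lintegral_enorm hm.1, ← eLpNorm_one_eq_lintegral_enorm]
  exact ENNReal.toReal_mono hm.2.ne (eLpNorm_le_eLpNorm_of_exponent_le (by norm_num) hm.1)

/-- If each strict record low of a sequence starting at `0` undercuts all earlier values by more
than `ε`, then a lower bound `-K` for the sequence bounds the number of such records. -/
theorem mul_card_records_le {s : ℕ → ℝ} (hs : s 0 = 0) {ε K : ℝ} {M : ℕ}
    (hK : ∀ n ≤ M, -s n ≤ K) :
    ε * ((Finset.range M).filter fun N => ∀ j ≤ N, s (N + 1) < s j - ε).card ≤ K := by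
  classical
  suffices h : ∃ τ ≤ M,
      s τ ≤ -(ε * ((Finset.range M).filter fun N => ∀ j ≤ N, s (N + 1) < s j - ε).card) by
    obtain ⟨τ, hτ, h⟩ := h
    linarith [hK τ hτ]
  clear hK
  induction M with
  | zero => exact ⟨0, le_rfl, by simp [hs]⟩
  | succ M ih =>
    obtain ⟨τ, hτ, h⟩ := ih
    rw [Finset.range_add_one, Finset.filter_insert]
    split_ifs with hM
    · refine ⟨M + 1, le_rfl, ?_⟩
      rw [Finset.card_insert_of_notMem (by simp)]
      push_cast
      linarith [hM τ hτ]
    · exact ⟨τ, hτ.trans M.le_succ, h⟩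

theorem continuous_birkhoffSum {X : Type*} [TopologicalSpace X] {f : X → X} (hf : Continuous f)
    {ψ : X → ℝ} (hψ : Continuous ψ) (n : ℕ) : Continuous (birkhoffSum f ψ n) :=
  continuous_finsetSum _ fun i _ => hψ.comp (hf.iterate i)

theorem abs_birkhoffSum_iterate_sub_le {X : Type*} {f : X → X} {ψ : X → ℝ} {C : ℝ}
    (hC : ∀ x, |ψ x| ≤ C) (n j : ℕ) (x : X) :
    |birkhoffSum f ψ n (f^[j] x) - birkhoffSum f ψ n x| ≤ 2 * C * j := by
  induction j with
  | zero => simp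
  | succ j ih =>
    have h := birkhoffSum_apply_sub_birkhoffSum f ψ n (f^[j] x)
    rw [← Function.iterate_succ_apply' f j x] at h
    rw [abs_le] at ih ⊢
    have h1 := abs_le.1 (hC (f^[n] (f^[j] x)))
    have h2 := abs_le.1 (hC (f^[j] x))
    push_cast
    constructor <;> linarith

theorem abs_birkhoffSum_le_sum_abs_birkhoffAverage {X : Type*} {f : X → X} {ψ : X → ℝ} {C : ℝ}
    (hC : ∀ x, |ψ x| ≤ C) {L : ℕ} (hL : L ≠ 0) {n M : ℕ} (hn : n ≤ M) (x : X) :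
    |birkhoffSum f ψ n x| ≤
      ∑ i ∈ Finset.range M, |birkhoffAverage ℝ f ψ L (f^[i] x)| + 2 * C * L := by
  have hC0 : 0 ≤ C := (abs_nonneg _).trans (hC x)
  have hL' : (0 : ℝ) < L := by positivity
  have hswap : ∑ i ∈ Finset.range n, birkhoffSum f ψ L (f^[i] x)
      = ∑ j ∈ Finset.range L, birkhoffSum f ψ n (f^[j] x) := by
    simp only [birkhoffSum]
    rw [Finset.sum_comm]
    refine Finset.sum_congr rfl fun i _ => Finset.sum_congr rfl fun j _ => ?_
    rw [← Function.iterate_add_apply, ← Function.iterate_add_apply, add_comm]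
  have herr : |∑ j ∈ Finset.range L, birkhoffSum f ψ n (f^[j] x) - L * birkhoffSum f ψ n x|
      ≤ L * (2 * C * L) := by
    have : (L : ℝ) * birkhoffSum f ψ n x = ∑ j ∈ Finset.range L, birkhoffSum f ψ n x := by simp
    rw [this, ← Finset.sum_sub_distrib]
    refine (Finset.abs_sum_le_sum_abs _ _).trans ?_
    refine (Finset.sum_le_card_nsmul _ _ (2 * C * L) fun j hj => ?_).trans (by simp)
    refine (abs_birkhoffSum_iterate_sub_le hC n j x).trans ?_
    have : (j : ℝ) ≤ L := by exact_mod_cast (Finset.mem_range.1 hj).le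
    gcongr
  have hsum : |∑ i ∈ Finset.range n, birkhoffSum f ψ L (f^[i] x)| ≤
      L * ∑ i ∈ Finset.range M, |birkhoffAverage ℝ f ψ L (f^[i] x)| := by
    refine (Finset.abs_sum_le_sum_abs _ _).trans ?_
    rw [Finset.mul_sum]
    refine (Finset.sum_le_sum_of_subset_of_nonneg (Finset.range_subset_range.2 hn)
      fun _ _ _ => abs_nonneg _).trans (Finset.sum_le_sum fun i _ => le_of_eq ?_)
    rw [birkhoffAverage, smul_eq_mul, abs_mul, abs_inv, abs_of_pos hL',
      mul_inv_cancel_left₀ hL'.ne']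
  rw [hswap] at hsum
  have : (L : ℝ) * |birkhoffSum f ψ n x| ≤
      L * (∑ i ∈ Finset.range M, |birkhoffAverage ℝ f ψ L (f^[i] x)| + 2 * C * L) := by
    rw [← abs_of_pos hL', ← abs_mul, abs_of_pos hL', mul_add]
    rw [abs_le] at *
    constructor <;> linarith
  exact le_of_mul_le_mul_left this hL'

/-- The points `w` whose `N + 1` step Birkhoff sum lies more than `ε` below all shorter ones form
a set of small measure for suitable `N`. -/
theorem Ergodic.exists_measureReal_record_le {X : Type*} [TopologicalSpace X] [CompactSpace X]
    [MeasurableSpace X] [BorelSpace X] {ν : Measure X} [IsProbabilityMeasure ν] {f : X → X}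
    (hfc : Continuous f) (hf : Ergodic f ν) {ψ : X → ℝ} (hψ : Continuous ψ)
    (h0 : ∫ x, ψ x ∂ν = 0) {ε η : ℝ} (hε : 0 < ε) (hη : 0 < η) :
    ∃ N : ℕ, ν.real {w | ∀ j ≤ N, birkhoffSum f ψ (N + 1) w < birkhoffSum f ψ j w - ε} ≤ η := by
  classical
  by_contra! hB
  set B : ℕ → Set X :=
    fun N => {w | ∀ j ≤ N, birkhoffSum f ψ (N + 1) w < birkhoffSum f ψ j w - ε} with hBdef
  have hcont := continuous_birkhoffSum hfc hψ
  have hBmeas : ∀ N, MeasurableSet (B N) := fun N => by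
    simp only [hBdef, Set.ofPred_forall]
    exact MeasurableSet.iInter fun j => MeasurableSet.iInter fun _ =>
      (isOpen_lt (hcont _) ((hcont _).sub continuous_const)).measurableSet
  obtain ⟨C, hC⟩ : ∃ C, ∀ x, |ψ x| ≤ C := by
    obtain ⟨C, hC⟩ := isCompact_univ.exists_bound_of_continuousOn hψ.continuousOn
    exact ⟨C, fun x => hC x trivial⟩
  have hψ2 : MemLp ψ 2 ν :=
    MemLp.of_bound hψ.measurable.aestronglyMeasurable C (Eventually.of_forall hC)
  have hint : ∀ g : X → ℝ, Continuous g → Integrable g ν := fun g hg =>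
    hg.integrable_of_hasCompactSupport (HasCompactSupport.of_compactSpace g)
  have hA : ∀ L, Continuous fun x => |birkhoffAverage ℝ f ψ L x| := fun L =>
    ((hcont L).const_smul ((L : ℝ)⁻¹)).abs
  have hmain : ∀ L : ℕ, L ≠ 0 → ∀ M : ℕ,
      ε * (M * η) ≤ M * ∫ x, |birkhoffAverage ℝ f ψ L x| ∂ν + 2 * C * L := by
    intro L hL M
    have hpt : ∀ w, ε * ∑ N ∈ Finset.range M, (B N).indicator (fun _ => (1 : ℝ)) w ≤
        ∑ i ∈ Finset.range M, |birkhoffAverage ℝ f ψ L (f^[i] w)| + 2 * C * L := by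
      intro w
      refine le_trans (le_of_eq ?_) (mul_card_records_le (s := fun n => birkhoffSum f ψ n w)
        (ε := ε) (M := M) (by simp) fun n hn => (neg_le_abs _).trans
          (abs_birkhoffSum_le_sum_abs_birkhoffAverage hC hL hn w))
      congr 1
      rw [Finset.natCast_card_filter]
      exact Finset.sum_congr rfl fun N _ => by simp [Set.indicator_apply, hBdef]
    have hi1 : ∀ N ∈ Finset.range M, Integrable ((B N).indicator (fun _ => (1 : ℝ))) ν :=
      fun N _ => (integrable_const _).indicator (hBmeas N)
    have hi2 : ∀ i ∈ Finset.range M,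
        Integrable (fun w => |birkhoffAverage ℝ f ψ L (f^[i] w)|) ν :=
      fun i _ => hint _ ((hA L).comp (hfc.iterate i))
    have h := integral_mono ((integrable_finsetSum _ hi1).const_mul ε)
      ((integrable_finsetSum _ hi2).add (integrable_const (2 * C * L))) (by
        intro w
        simpa using hpt w)
    simp only [Pi.add_apply] at h
    rw [integral_const_mul] at h
    rw [integral_finsetSum _ hi1, integral_add (integrable_finsetSum _ hi2)
      (integrable_const _), integral_finsetSum _ hi2] at h
    have hr : ∀ i, ∫ w, |birkhoffAverage ℝ f ψ L (f^[i] w)| ∂ν =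
        ∫ w, |birkhoffAverage ℝ f ψ L w| ∂ν := fun i => by
      have hi := hf.toMeasurePreserving.iterate i
      have := integral_map (μ := ν) hi.measurable.aemeasurable
        (f := fun w => |birkhoffAverage ℝ f ψ L w|) (hA L).measurable.aestronglyMeasurable
      rw [hi.map_eq] at this
      exact this.symm
    simp only [hr, integral_indicator_const _ (hBmeas _), integral_const, Finset.sum_const,
      Finset.card_range, nsmul_eq_mul, smul_eq_mul, mul_one, probReal_univ, one_mul] at h
    refine le_trans ?_ h
    gcongr
    calc (M : ℝ) * η = ∑ N ∈ Finset.range M, η := by simp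
      _ ≤ _ := Finset.sum_le_sum fun N _ => (hB N).le
  have hle : ∀ L : ℕ, L ≠ 0 → ε * η ≤ ∫ x, |birkhoffAverage ℝ f ψ L x| ∂ν := by
    intro L hL
    by_contra! hlt
    obtain ⟨M, hM⟩ := exists_nat_gt
      (2 * C * L / (ε * η - ∫ x, |birkhoffAverage ℝ f ψ L x| ∂ν))
    rw [div_lt_iff₀ (sub_pos.2 hlt)] at hM
    linarith [hmain L hL M]
  have := ge_of_tendsto (hf.tendsto_integral_abs_birkhoffAverage hψ2 h0)
    ((eventually_ne_atTop 0).mono hle)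
  nlinarith [mul_pos hε hη]

/-- The points reached from `A` in between `1` and `N` steps of `f` along an orbit segment whose
Birkhoff sum is at least `-ε`. -/
def reachableSet {X : Type*} (f : X → X) (ψ : X → ℝ) (N : ℕ) (ε : ℝ) (A : Set X) : Set X :=
  ⋃ n ∈ Set.Icc 1 N, f^[n] '' ({y | -ε ≤ birkhoffSum f ψ n y} ∩ A)

theorem mem_reachableSet {X : Type*} {f : X → X} {ψ : X → ℝ} {N : ℕ} {ε : ℝ} {A : Set X} {x : X} :
    x ∈ reachableSet f ψ N ε A ↔
      ∃ n, (1 ≤ n ∧ n ≤ N) ∧ ∃ y, (-ε ≤ birkhoffSum f ψ n y ∧ y ∈ A) ∧ f^[n] y = x := by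
  simp [reachableSet]

theorem reachableSet_mono {X : Type*} {f : X → X} {ψ : X → ℝ} {N : ℕ} {ε : ℝ} {A B : Set X}
    (h : A ⊆ B) : reachableSet f ψ N ε A ⊆ reachableSet f ψ N ε B :=
  Set.biUnion_mono subset_rfl fun _ _ => Set.image_mono (Set.inter_subset_inter_right _ h)

theorem isClosed_reachableSet {X : Type*} [TopologicalSpace X] [CompactSpace X] [T2Space X]
    {f : X → X} (hf : Continuous f) {ψ : X → ℝ} (hψ : Continuous ψ) (N : ℕ) (ε : ℝ) {A : Set X}
    (hA : IsClosed A) : IsClosed (reachableSet f ψ N ε A) := by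
  refine (Set.finite_Icc 1 N).isClosed_biUnion fun n _ => ?_
  exact (((isClosed_le continuous_const (continuous_birkhoffSum hf hψ n)).inter hA).isCompact.image
    (hf.iterate n)).isClosed

theorem measureReal_compl_reachableSet_le {X : Type*} [MeasurableSpace X] {ν : Measure X}
    [IsProbabilityMeasure ν] {f : X → X} (hf : MeasurePreserving f ν ν) {ψ : X → ℝ} {N : ℕ}
    {ε η δ : ℝ} {A : Set X} (hA : MeasurableSet A)
    (hR : MeasurableSet (reachableSet f ψ (N + 1) ε A))
    (hN : ν.real {w | ∀ j ≤ N, birkhoffSum f ψ (N + 1) w < birkhoffSum f ψ j w - ε} ≤ η)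
    (hδ : ν.real Aᶜ ≤ δ) :
    ν.real (reachableSet f ψ (N + 1) ε A)ᶜ ≤ η + (N + 1) * δ := by
  have hpre : ∀ n {s : Set X}, MeasurableSet s → ν.real (f^[n] ⁻¹' s) = ν.real s :=
    fun n s hs => by
      rw [measureReal_def, (hf.iterate n).measure_preimage hs.nullMeasurableSet, measureReal_def]
  rw [← hpre (N + 1) hR.compl]
  have hsub : f^[N + 1] ⁻¹' (reachableSet f ψ (N + 1) ε A)ᶜ ⊆
      {w | ∀ j ≤ N, birkhoffSum f ψ (N + 1) w < birkhoffSum f ψ j w - ε} ∪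
        ⋃ j ∈ Finset.range (N + 1), f^[j] ⁻¹' Aᶜ := by
    intro w hw
    by_contra hc
    simp only [Set.mem_union, Set.mem_ofPred_eq, Set.mem_iUnion, Finset.mem_range,
      Set.mem_preimage, Set.mem_compl_iff, not_or, not_forall, not_lt, not_exists,
      not_not] at hc
    obtain ⟨⟨j, hj, hS⟩, hmem⟩ := hc
    refine hw (mem_reachableSet.2 ⟨N + 1 - j, ⟨by omega, by omega⟩, f^[j] w,
      ⟨?_, hmem j (by omega)⟩, ?_⟩)
    · have h := birkhoffSum_add f ψ j (N + 1 - j) w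
      rw [show j + (N + 1 - j) = N + 1 by omega] at h
      linarith
    · rw [← Function.iterate_add_apply, Nat.sub_add_cancel (by omega)]
  refine (measureReal_mono hsub).trans ((measureReal_union_le _ _).trans
    (add_le_add hN ((measureReal_biUnion_finset_le _ _).trans ?_)))
  simp only [hpre _ hA.compl, Finset.sum_const, Finset.card_range, nsmul_eq_mul]
  push_cast
  gcongr

/-- The points that admit `k` successive preimages, the one with index `l` being at most `N (i + l)`
steps back with Birkhoff sum at least `-ε (i + l)`. -/
def chainSet {X : Type*} (f : X → X) (ψ : X → ℝ) (N : ℕ → ℕ) (ε : ℕ → ℝ) : ℕ → ℕ → Set X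
  | 0, _ => Set.univ
  | k + 1, i => reachableSet f ψ (N i) (ε i) (chainSet f ψ N ε k (i + 1))

section chainSet

variable {X : Type*} {f : X → X} {ψ : X → ℝ} {N : ℕ → ℕ} {ε : ℕ → ℝ}

theorem chainSet_succ_subset (k i : ℕ) :
    chainSet f ψ N ε (k + 1) i ⊆ chainSet f ψ N ε k i := by
  induction k generalizing i with
  | zero => exact Set.subset_univ _
  | succ k ih => exact reachableSet_mono (ih (i + 1))

variable [TopologicalSpace X] [CompactSpace X] [T2Space X]

theorem isClosed_chainSet (hf : Continuous f) (hψ : Continuous ψ) (k i : ℕ) :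
    IsClosed (chainSet f ψ N ε k i) := by
  induction k generalizing i with
  | zero => exact isClosed_univ
  | succ k ih => exact isClosed_reachableSet hf hψ _ _ (ih (i + 1))

theorem exists_of_mem_iInter_chainSet (hf : Continuous f) (hψ : Continuous ψ) {i : ℕ} {x : X}
    (hx : x ∈ ⋂ k, chainSet f ψ N ε k i) :
    ∃ n, 1 ≤ n ∧ ∃ y ∈ ⋂ k, chainSet f ψ N ε k (i + 1),
      -ε i ≤ birkhoffSum f ψ n y ∧ f^[n] y = x := by
  let K : ℕ → Set (ℕ × X) := fun k =>
    (Set.Icc 1 (N i) ×ˢ chainSet f ψ N ε k (i + 1)) ∩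
      {q | -ε i ≤ birkhoffSum f ψ q.1 q.2 ∧ f^[q.1] q.2 = x}
  have hcl : ∀ k, IsClosed (K k) := fun k => by
    refine ((isClosed_discrete _).prod (isClosed_chainSet hf hψ k (i + 1))).inter
      (IsClosed.inter ?_ ?_)
    · have hS : Continuous fun q : ℕ × X => birkhoffSum f ψ q.1 q.2 :=
        continuous_prod_of_discrete_left.2 (continuous_birkhoffSum hf hψ)
      exact isClosed_le continuous_const hS
    · exact isClosed_eq (continuous_prod_of_discrete_left.2 fun n => hf.iterate n)
        continuous_const
  have hK : (⋂ k, K k).Nonempty := by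
    refine IsCompact.nonempty_iInter_of_sequence_nonempty_isCompact_isClosed K (fun k => ?_)
      (fun k => ?_) ?_ hcl
    · exact Set.inter_subset_inter_left _ (Set.prod_mono_right (chainSet_succ_subset k (i + 1)))
    · obtain ⟨n, hn, y, ⟨hS, hy⟩, hxy⟩ := mem_reachableSet.1 (Set.mem_iInter.1 hx (k + 1))
      exact ⟨(n, y), ⟨hn, hy⟩, hS, hxy⟩
    · exact ((Set.finite_Icc 1 (N i)).isCompact.prod isCompact_univ).of_isClosed_subset (hcl 0)
        Set.inter_subset_left
  obtain ⟨⟨n, y⟩, hq⟩ := hK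
  rw [Set.mem_iInter] at hq
  exact ⟨n, (hq 0).1.1.1, y, Set.mem_iInter.2 fun k => (hq k).1.2, (hq 0).2⟩

theorem exists_chain_of_mem_iInter_chainSet (hf : Continuous f) (hψ : Continuous ψ) {x : X}
    (hx : x ∈ ⋂ k, chainSet f ψ N ε k 0) :
    ∃ n : ℕ → ℕ, StrictMono n ∧ (∀ l, 1 ≤ n l) ∧ ∃ xs : ℕ → X, (∀ l, f^[n l] (xs l) = x) ∧
      (∀ l, f^[n (l + 1) - n l] (xs (l + 1)) = xs l) ∧
      ∀ l, -∑ i ∈ Finset.range (l + 1), ε i ≤ birkhoffSum f ψ (n l) (xs l) := by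
  choose! m hm y hy hS hmy using
    fun (i : ℕ) (x : X) (hx : x ∈ ⋂ k, chainSet f ψ N ε k i) =>
      exists_of_mem_iInter_chainSet hf hψ hx
  let z : ℕ → X := fun i => Nat.rec x y i
  have hz : ∀ i, z i ∈ ⋂ k, chainSet f ψ N ε k i := fun i => by
    induction i with
    | zero => exact hx
    | succ i ih => exact hy i _ ih
  have hzf : ∀ i, f^[m i (z i)] (z (i + 1)) = z i := fun i => hmy i _ (hz i)
  let n : ℕ → ℕ := fun l => ∑ i ∈ Finset.range (l + 1), m i (z i)
  have hn : ∀ l, n (l + 1) = n l + m (l + 1) (z (l + 1)) := fun l => Finset.sum_range_succ _ _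
  have hn0 : n 0 = m 0 (z 0) := by simp [n]
  have hmono : StrictMono n := strictMono_nat_of_lt_succ fun l => by
    have := hm (l + 1) _ (hz (l + 1))
    have := hn l
    omega
  refine ⟨n, hmono, fun l => ?_, fun l => z (l + 1), fun l => ?_, fun l => ?_, fun l => ?_⟩
  · exact (hn0 ▸ hm 0 _ (hz 0)).trans (hmono.monotone l.zero_le)
  · induction l with
    | zero => rw [hn0]; exact hzf 0
    | succ l ih => rw [hn, Function.iterate_add_apply, hzf, ih]
  · rw [hn, Nat.add_sub_cancel_left]
    exact hzf (l + 1)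
  · induction l with
    | zero =>
      rw [hn0, zero_add, Finset.sum_range_one]
      exact hS 0 _ (hz 0)
    | succ l ih =>
      have h := hS (l + 1) _ (hz (l + 1))
      rw [hn, add_comm (n l), birkhoffSum_add, hzf, Finset.sum_range_succ]
      have h' : -ε (l + 1) ≤ birkhoffSum f ψ (m (l + 1) (z (l + 1))) (z (l + 1 + 1)) := h
      linarith

variable [MeasurableSpace X] [BorelSpace X] {ν : Measure X} [IsProbabilityMeasure ν]

theorem Ergodic.exists_measureReal_compl_chainSet_le (hfc : Continuous f) (hf : Ergodic f ν)
    (hψ : Continuous ψ) (h0 : ∫ x, ψ x ∂ν = 0) (hε : ∀ i, 0 < ε i) {η : ℝ} (hη : 0 < η) :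
    ∃ N : ℕ → ℕ, ∀ k, ν.real (chainSet f ψ N ε k 0)ᶜ ≤ η := by
  choose! R hR using fun (i : ℕ) (δ : ℝ) (hδ : 0 < δ) =>
    hf.exists_measureReal_record_le hfc hψ h0 (hε i) (half_pos hδ)
  obtain ⟨δ, hδη, hδ, hδs⟩ : ∃ δ : ℕ → ℝ, δ 0 = η ∧ (∀ i, 0 < δ i) ∧
      ∀ i, δ i / 2 + (R i (δ i) + 1) * δ (i + 1) = δ i := by
    let δ : ℕ → ℝ := fun i => Nat.rec η (fun i d => d / 2 / (R i d + 1)) i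
    refine ⟨δ, rfl, fun i => ?_, fun i => ?_⟩
    · induction i with
      | zero => exact hη
      | succ i ih => exact div_pos (half_pos ih) (by positivity)
    · have : δ (i + 1) = δ i / 2 / (R i (δ i) + 1) := rfl
      rw [this, mul_div_cancel₀ _ (by positivity), add_halves]
  refine ⟨fun i => R i (δ i) + 1, fun k => ?_⟩
  suffices h : ∀ i, ν.real (chainSet f ψ (fun i => R i (δ i) + 1) ε k i)ᶜ ≤ δ i from
    (h 0).trans_eq hδη
  induction k with
  | zero => intro i; simpa [chainSet] using (hδ i).le
  | succ k ih =>
    intro i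
    rw [← hδs i]
    have hcl := isClosed_chainSet (N := fun i => R i (δ i) + 1) (ε := ε) hfc hψ (k + 1) i
    rw [chainSet] at hcl ⊢
    exact measureReal_compl_reachableSet_le hf.toMeasurePreserving
      (isClosed_chainSet hfc hψ k (i + 1)).measurableSet hcl.measurableSet
      (hR i (δ i) (hδ i)) (ih (i + 1))

theorem Ergodic.exists_measureReal_compl_iInter_chainSet_le (hfc : Continuous f)
    (hf : Ergodic f ν) (hψ : Continuous ψ) (h0 : ∫ x, ψ x ∂ν = 0) (hε : ∀ i, 0 < ε i) {η : ℝ}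
    (hη : 0 < η) : ∃ N : ℕ → ℕ, ν.real (⋂ k, chainSet f ψ N ε k 0)ᶜ ≤ η := by
  obtain ⟨N, hN⟩ := hf.exists_measureReal_compl_chainSet_le hfc hψ h0 hε hη
  refine ⟨N, ?_⟩
  have hmono : Monotone fun k => (chainSet f ψ N ε k 0)ᶜ :=
    monotone_nat_of_le_succ fun k => Set.compl_subset_compl.2 (chainSet_succ_subset k 0)
  rw [Set.compl_iInter]
  exact le_of_tendsto ((ENNReal.tendsto_toReal (measure_ne_top _ _)).comp
    (tendsto_measure_iUnion_atTop hmono)) (Eventually.of_forall hN)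

end chainSet

/-- For an ergodic invariant measure `ν` of a continuous surjective map of a compact
metric space, for `ν`-a.e. `x` and every `D' > 0` there are backward times `n_l` and
compatible preimages `x_l ∈ f^{-n_l}(x)` along which the Birkhoff sums of `φ` are
within `D'` of `n_l ∫ φ dν`. -/
theorem stmt15 {X : Type*} [MetricSpace X] [CompactSpace X]
    [MeasurableSpace X] [BorelSpace X]
    (f : X → X) (hf : Continuous f) (hfsurj : Function.Surjective f)
    (φ : X → ℝ) (hφ : Continuous φ)
    (ν : Measure X) [IsProbabilityMeasure ν] (hergo : Ergodic f ν) :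
    ∀ᵐ x ∂ν, ∀ D' : ℝ, 0 < D' →
      ∃ n : ℕ → ℕ, StrictMono n ∧ (∀ l, 1 ≤ n l) ∧
      ∃ xs : ℕ → X,
        (∀ l, f^[n l] (xs l) = x) ∧
        (∀ l, f^[n (l + 1) - n l] (xs (l + 1)) = xs l) ∧
        (∀ l, (n l : ℝ) * ∫ z, φ z ∂ν - D' ≤
          ∑ j ∈ Finset.range (n l), φ (f^[j] (xs l))) := by
  let ψ : X → ℝ := fun x => φ x - ∫ z, φ z ∂ν
  have hψ : Continuous ψ := hφ.sub continuous_const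
  have h0 : ∫ x, ψ x ∂ν = 0 := by
    have hi : Integrable φ ν :=
      hφ.integrable_of_hasCompactSupport (HasCompactSupport.of_compactSpace φ)
    simp [ψ, integral_sub hi (integrable_const _)]
  let ε : ℕ → ℕ → ℝ := fun p i => 1 / (p + 1) / 2 / 2 ^ i
  have hε : ∀ p i, 0 < ε p i := fun p i => by positivity
  have hεsum : ∀ p l, ∑ i ∈ Finset.range l, ε p i ≤ 1 / (p + 1) := fun p l =>
    ((summable_geometric_two' _).sum_le_tsum _ fun i _ => (hε p i).le).trans
      (tsum_geometric_two' _).le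
  have hae : ∀ᵐ x ∂ν, ∀ p : ℕ, ∃ N : ℕ → ℕ, x ∈ ⋂ k, chainSet f ψ N (ε p) k 0 := by
    refine ae_all_iff.2 fun p => ?_
    have hle : ∀ η : ℝ, 0 < η →
        ν.real {x | ∃ N : ℕ → ℕ, x ∈ ⋂ k, chainSet f ψ N (ε p) k 0}ᶜ ≤ η := fun η hη => by
      obtain ⟨N, hN⟩ := hergo.exists_measureReal_compl_iInter_chainSet_le hf hψ h0 (hε p) hη
      have hsub : (⋂ k, chainSet f ψ N (ε p) k 0) ⊆
          {x | ∃ N : ℕ → ℕ, x ∈ ⋂ k, chainSet f ψ N (ε p) k 0} := fun x hx => ⟨N, hx⟩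
      exact (measureReal_mono (Set.compl_subset_compl.2 hsub)).trans hN
    exact (measureReal_eq_zero_iff).1
      (le_antisymm (le_of_forall_pos_le_add fun η hη => by simpa using hle η hη)
        measureReal_nonneg)
  filter_upwards [hae] with x hx D hD
  obtain ⟨p, hp⟩ := exists_nat_one_div_lt hD
  obtain ⟨N, hN⟩ := hx p
  obtain ⟨n, hmono, hn, xs, hxs, hxs', hS⟩ := exists_chain_of_mem_iInter_chainSet hf hψ hN
  refine ⟨n, hmono, hn, xs, hxs, hxs', fun l => ?_⟩
  have h : birkhoffSum f ψ (n l) (xs l) =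
      ∑ j ∈ Finset.range (n l), φ (f^[j] (xs l)) - n l * ∫ z, φ z ∂ν := by
    simp [birkhoffSum, ψ, Finset.sum_sub_distrib]
  linarith [hS l, hεsum p (l + 1)]
end
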